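/- Let n > 0, and let s and ρ be real numbers with ρ > 0, s < 0, and s² = ρ² + 2n. Let r ≥ 2 be an integer, and let c and c′ be real numbers satisfying c ≤ c′, c/r ≥ s + ρ, and c′/(r−1) ≤ s − ρ. Then ρ² ≤ n/4. -/

import Mathlib

/-- Numerical core of the higher-rank wall bound for `ℙ²`: if the wall for the ideal
sheaf of `n` points has center `(s,0)` with `s < 0` and radius `ρ > 0` with
`s² = ρ² + 2n`, and a destabilizing subobject of rank `r ≥ 2` has `c₁ = c`, kernel
with `c₁ = c' ≥ c`, with `c/r ≥ s + ρ` and `c'/(r−1) ≤ s − ρ`, then `ρ² ≤ n/4`. -/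
theorem higher_rank_wall_bound (n : ℕ) (hn : 0 < n) (s ρ : ℝ) (hρ : 0 < ρ) (hs : s < 0)
    (hcirc : s ^ 2 = ρ ^ 2 + 2 * (n : ℝ)) (r : ℤ) (hr : 2 ≤ r) (c c' : ℝ)
    (hcc : c ≤ c') (hF : s + ρ ≤ c / (r : ℝ)) (hK : c' / ((r : ℝ) - 1) ≤ s - ρ) :
    ρ ^ 2 ≤ (n : ℝ) / 4 := by
  have hr' : (2 : ℝ) ≤ r := by exact_mod_cast hr
  rw [le_div_iff₀ (by linarith)] at hF
  rw [div_le_iff₀ (by linarith)] at hK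
  have h : 3 * ρ ≤ -s := by nlinarith
  nlinarith
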